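/- The group $\widehat{G}_* = T^{-1}\widehat{G}T$ equals $\{h \in \mathbb{C}^{4\times 4} \mid {}^t h J_4 h = J_4,\ Qh = hQ \text{ or } Qh = -hQ,\ h \in T^{-1}Sp(4,\mathbb{R})T\}$; equivalently, $h = \begin{pmatrix} \alpha & \beta \\ \overline{\beta} & \overline{\alpha} \end{pmatrix}$ with $\alpha, \beta \in \mathbb{C}^{2\times 2}$ lies in $\widehat{G}_*$ if and only if $\alpha\,{}^t\overline{\alpha} - \beta\,{}^t\overline{\beta} = I_2$, $\alpha\,{}^t\overline{\beta} = \overline{\beta}\,{}^t\alpha$, and $Qh = \varepsilon\, hQ$ for some $\varepsilon \in \{1,-1\}$. -/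

import Mathlib

open Matrix Complex

noncomputable section

/-- `J₄ = [[0, I₂], [-I₂, 0]]`. -/
def J4 : Matrix (Fin 4) (Fin 4) ℝ :=
  !![0,0,1,0; 0,0,0,1; -1,0,0,0; 0,-1,0,0]

/-- The symplectic group `Sp(4,ℝ)`. -/
def Sp4 : Set (Matrix (Fin 4) (Fin 4) ℝ) :=
  {M | IsUnit M.det ∧ Mᵀ * J4 * M = J4}

/-- `Q = [[q, 0], [0, q]]` with `q = [[0,1],[1,0]]`. -/
def QM : Matrix (Fin 4) (Fin 4) ℝ :=
  !![0,1,0,0; 1,0,0,0; 0,0,0,1; 0,0,1,0]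

/-- Upper-left 2×2 block (complexified). -/
def blkA (M : Matrix (Fin 4) (Fin 4) ℝ) : Matrix (Fin 2) (Fin 2) ℂ :=
  Matrix.of fun i j => (M (Fin.castAdd 2 i) (Fin.castAdd 2 j) : ℂ)

def blkB (M : Matrix (Fin 4) (Fin 4) ℝ) : Matrix (Fin 2) (Fin 2) ℂ :=
  Matrix.of fun i j => (M (Fin.castAdd 2 i) (Fin.natAdd 2 j) : ℂ)

def blkC (M : Matrix (Fin 4) (Fin 4) ℝ) : Matrix (Fin 2) (Fin 2) ℂ :=
  Matrix.of fun i j => (M (Fin.natAdd 2 i) (Fin.castAdd 2 j) : ℂ)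

def blkD (M : Matrix (Fin 4) (Fin 4) ℝ) : Matrix (Fin 2) (Fin 2) ℂ :=
  Matrix.of fun i j => (M (Fin.natAdd 2 i) (Fin.natAdd 2 j) : ℂ)

/-- The action `M⟨Ω⟩ = (AΩ + B)(CΩ + D)⁻¹`. -/
def act (M : Matrix (Fin 4) (Fin 4) ℝ) (Ω : Matrix (Fin 2) (Fin 2) ℂ) :
    Matrix (Fin 2) (Fin 2) ℂ :=
  (blkA M * Ω + blkB M) * (blkC M * Ω + blkD M)⁻¹

/-- The Siegel upper half plane of degree 2. -/
def H2 : Set (Matrix (Fin 2) (Fin 2) ℂ) :=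
  {Ω | Ωᵀ = Ω ∧ (Matrix.of fun i j => (Ω i j).im : Matrix (Fin 2) (Fin 2) ℝ).PosDef}

/-- The new kind Siegel upper half space `Ĥ₂ = {Ω ∈ H₂ | Q⟨Ω⟩ = Ω}`. -/
def HHat2 : Set (Matrix (Fin 2) (Fin 2) ℂ) :=
  {Ω | Ω ∈ H2 ∧ act QM Ω = Ω}
/-- The matrix `T = (1/√2) [[I₂, I₂], [iI₂, -iI₂]]` of the Cayley transform. -/
def Tmat : Matrix (Fin 4) (Fin 4) ℂ :=
  ((Real.sqrt 2 : ℂ))⁻¹ •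
    !![1,0,1,0; 0,1,0,1; Complex.I,0,-Complex.I,0; 0,Complex.I,0,-Complex.I]

/-- Assemble a 4×4 complex matrix from four 2×2 blocks. -/
def fromB (a b c d : Matrix (Fin 2) (Fin 2) ℂ) : Matrix (Fin 4) (Fin 4) ℂ :=
  Matrix.reindex finSumFinEquiv finSumFinEquiv (Matrix.fromBlocks a b c d)

/-- Entrywise complex conjugate of a matrix. -/
def cj (A : Matrix (Fin 2) (Fin 2) ℂ) : Matrix (Fin 2) (Fin 2) ℂ :=
  A.map (starRingEnd ℂ)


/-- Complexification of `J₄`. -/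
def J4C : Matrix (Fin 4) (Fin 4) ℂ := J4.map Complex.ofReal

/-- `I_{2,2} = [[I₂, 0], [0, -I₂]]`. -/
def I22 : Matrix (Fin 4) (Fin 4) ℂ := !![1,0,0,0; 0,1,0,0; 0,0,-1,0; 0,0,0,-1]

/-- `SU(2,2) = {h | ᵗh I_{2,2} h̄ = I_{2,2}}`. -/
def SU22 : Set (Matrix (Fin 4) (Fin 4) ℂ) :=
  {h | hᵀ * I22 * h.map (starRingEnd ℂ) = I22}

/-- `Sp(4,ℂ) = {α | ᵗα J₄ α = J₄}`. -/
def Sp4C : Set (Matrix (Fin 4) (Fin 4) ℂ) :=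
  {h | hᵀ * J4C * h = J4C}

/-- `G_* = T⁻¹ Sp(4,ℝ) T`. -/
def Gstar : Set (Matrix (Fin 4) (Fin 4) ℂ) :=
  (fun M : Matrix (Fin 4) (Fin 4) ℝ => Tmat⁻¹ * M.map Complex.ofReal * Tmat) '' Sp4

/-- `Ĝ = {M ∈ Sp(4,ℝ) | M⟨Ω⟩ ∈ Ĥ₂ for all Ω ∈ Ĥ₂}`. -/
def GHat : Set (Matrix (Fin 4) (Fin 4) ℝ) :=
  {M | M ∈ Sp4 ∧ ∀ Ω ∈ HHat2, act M Ω ∈ HHat2}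

/-- Complexification of `Q`. -/
def QC : Matrix (Fin 4) (Fin 4) ℂ := QM.map Complex.ofReal

/-- `Ĝ_* = T⁻¹ Ĝ T`. -/
def GHatStar : Set (Matrix (Fin 4) (Fin 4) ℂ) :=
  (fun M : Matrix (Fin 4) (Fin 4) ℝ => Tmat⁻¹ * M.map Complex.ofReal * Tmat) '' GHat

lemma fromB_eq (a b c d : Matrix (Fin 2) (Fin 2) ℂ) :
    fromB a b c d = !![a 0 0, a 0 1, b 0 0, b 0 1; a 1 0, a 1 1, b 1 0, b 1 1;
      c 0 0, c 0 1, d 0 0, d 0 1; c 1 0, c 1 1, d 1 0, d 1 1] := by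
  ext i j
  fin_cases i <;> fin_cases j <;> rfl

lemma sympl_block_relations {M : Matrix (Fin 4) (Fin 4) ℝ} (h : Mᵀ * J4 * M = J4) :
    (blkA M)ᵀ * blkC M = (blkC M)ᵀ * blkA M ∧ (blkB M)ᵀ * blkD M = (blkD M)ᵀ * blkB M ∧
    (blkA M)ᵀ * blkD M - (blkC M)ᵀ * blkB M = 1 := by
  have e (i j) : (M 0 i * M 2 j + M 1 i * M 3 j - M 2 i * M 0 j - M 3 i * M 1 j : ℂ) = J4 i j := by
    rw [← h]
    simp [Matrix.mul_apply, Fin.sum_univ_four, J4]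
    ring
  refine ⟨?_, ?_, ?_⟩ <;> ext i j
  · have := e (Fin.castAdd 2 i) (Fin.castAdd 2 j)
    fin_cases i <;> fin_cases j <;>
      simp [Matrix.mul_apply, Fin.sum_univ_two, blkA, blkC, Fin.natAdd, Fin.castAdd,
        J4] at this ⊢ <;>
      linear_combination this
  · have := e (Fin.natAdd 2 i) (Fin.natAdd 2 j)
    fin_cases i <;> fin_cases j <;>
      simp [Matrix.mul_apply, Fin.sum_univ_two, blkB, blkD, Fin.natAdd, Fin.castAdd,
        J4] at this ⊢ <;>
      linear_combination this
  · have := e (Fin.castAdd 2 i) (Fin.natAdd 2 j)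
    fin_cases i <;> fin_cases j <;>
      simp [Matrix.mul_apply, Fin.sum_univ_two, blkA, blkB, blkC, blkD, Fin.natAdd, Fin.castAdd,
        J4] at this ⊢ <;>
      linear_combination this

lemma act_QM (Ω : Matrix (Fin 2) (Fin 2) ℂ) : act QM Ω = !![0, 1; 1, 0] * Ω * !![0, 1; 1, 0] := by
  have hA : blkA QM = !![0, 1; 1, 0] := by ext i j; fin_cases i <;> fin_cases j <;> simp [blkA, QM]
  have hB : blkB QM = 0 := by ext i j; fin_cases i <;> fin_cases j <;> simp [blkB, QM]
  have hC : blkC QM = 0 := by ext i j; fin_cases i <;> fin_cases j <;> simp [blkC, QM]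
  have hD : blkD QM = !![0, 1; 1, 0] := by
    ext i j
    fin_cases i <;> fin_cases j <;> simp [blkD, QM, Fin.natAdd]
  have hinv : (!![0, 1; 1, 0] : Matrix (Fin 2) (Fin 2) ℂ)⁻¹ = !![0, 1; 1, 0] :=
    Matrix.inv_eq_right_inv (by ext i j; fin_cases i <;> fin_cases j <;> simp)
  simp only [act, hA, hB, hC, hD, hinv, add_zero, zero_mul, zero_add]

section

open scoped ComplexOrder

lemma posDef_map_ofReal_iff {S : Matrix (Fin 2) (Fin 2) ℝ} :
    (S.map Complex.ofReal).PosDef ↔ S.PosDef := by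
  refine ⟨fun h => .of_dotProduct_mulVec_pos ?_ fun x hx => ?_, fun h => ?_⟩
  · ext i j
    have := h.isHermitian.apply i j
    simpa using this
  · have := h.dotProduct_mulVec_pos (x := fun i => (x i : ℂ)) (by
      contrapose! hx; ext i; simpa using congrFun hx i)
    simp only [dotProduct, Matrix.mulVec, Fin.sum_univ_two, Matrix.map_apply, Pi.star_apply,
      RCLike.star_def, Complex.conj_ofReal, star_trivial] at this ⊢
    exact_mod_cast this
  · have hs : S 1 0 = S 0 1 := by simpa using h.isHermitian.apply 0 1
    have hpos (u : Fin 2 → ℝ) (hu : u ≠ 0) : 0 < u 0 * (S 0 0 * u 0 + S 0 1 * u 1) +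
        u 1 * (S 0 1 * u 0 + S 1 1 * u 1) := by
      simpa [dotProduct, Matrix.mulVec, Fin.sum_univ_two, hs] using h.dotProduct_mulVec_pos hu
    have hnonneg (u : Fin 2 → ℝ) : 0 ≤ u 0 * (S 0 0 * u 0 + S 0 1 * u 1) +
        u 1 * (S 0 1 * u 0 + S 1 1 * u 1) := by
      rcases eq_or_ne u 0 with rfl | hu
      · simp
      · exact (hpos u hu).le
    refine .of_dotProduct_mulVec_pos ?_ fun x hx => ?_
    · ext i j
      simpa using h.isHermitian.apply i j
    have hre := hnonneg fun i => (x i).re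
    have him := hnonneg fun i => (x i).im
    have hx' : (fun i => (x i).re) ≠ 0 ∨ (fun i => (x i).im) ≠ 0 := by
      contrapose! hx
      ext i
      exact Complex.ext (congrFun hx.1 i) (congrFun hx.2 i)
    simp [dotProduct, Matrix.mulVec, Fin.sum_univ_two, Complex.lt_def, hs]
    refine ⟨?_, by ring⟩
    rcases hx' with hx' | hx'
    · linarith [hpos _ hx']
    · linarith [hpos _ hx']

lemma mem_H2_iff {Ω : Matrix (Fin 2) (Fin 2) ℂ} :
    Ω ∈ H2 ↔ Ωᵀ = Ω ∧ ((-I / 2) • (Ω - Ωᴴ)).PosDef := by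
  refine and_congr_right fun h => ?_
  rw [← posDef_map_ofReal_iff]
  have : (-I / 2) • (Ω - Ωᴴ) =
      (Matrix.of fun i j => (Ω i j).im : Matrix (Fin 2) (Fin 2) ℝ).map ofReal := by
    ext i j
    have : Ω j i = Ω i j := congrFun (congrFun h i) j
    simp [this, Complex.ext_iff]
    ring
  rw [this]

lemma sub_eq_of_sympl {M : Matrix (Fin 4) (Fin 4) ℝ} (h : Mᵀ * J4 * M = J4)
    (S Ω : Matrix (Fin 2) (Fin 2) ℂ) :
    (S * (blkC M)ᵀ + (blkD M)ᵀ) * (blkA M * Ω + blkB M) -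
      (S * (blkA M)ᵀ + (blkB M)ᵀ) * (blkC M * Ω + blkD M) = Ω - S := by
  obtain ⟨h₁, h₂, h₃⟩ := sympl_block_relations h
  have h₄ : (blkD M)ᵀ * blkA M - (blkB M)ᵀ * blkC M = 1 := by
    simpa using congrArg Matrix.transpose h₃
  calc _ = S * ((blkC M)ᵀ * blkA M - (blkA M)ᵀ * blkC M) * Ω
        - S * ((blkA M)ᵀ * blkD M - (blkC M)ᵀ * blkB M)
        + ((blkD M)ᵀ * blkA M - (blkB M)ᵀ * blkC M) * Ω
        + ((blkD M)ᵀ * blkB M - (blkB M)ᵀ * blkD M) := by noncomm_ring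
    _ = _ := by
      rw [h₁, h₂, h₃, h₄]
      noncomm_ring

lemma conjTranspose_denom (M : Matrix (Fin 4) (Fin 4) ℝ) (Ω : Matrix (Fin 2) (Fin 2) ℂ) :
    (blkC M * Ω + blkD M)ᴴ = Ωᴴ * (blkC M)ᵀ + (blkD M)ᵀ := by
  have hC : (blkC M)ᴴ = (blkC M)ᵀ := by ext i j; simp [blkC]
  have hD : (blkD M)ᴴ = (blkD M)ᵀ := by ext i j; simp [blkD]
  simp [hC, hD]

lemma conjTranspose_num (M : Matrix (Fin 4) (Fin 4) ℝ) (Ω : Matrix (Fin 2) (Fin 2) ℂ) :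
    (blkA M * Ω + blkB M)ᴴ = Ωᴴ * (blkA M)ᵀ + (blkB M)ᵀ := by
  have hA : (blkA M)ᴴ = (blkA M)ᵀ := by ext i j; simp [blkA]
  have hB : (blkB M)ᴴ = (blkB M)ᵀ := by ext i j; simp [blkB]
  simp [hA, hB]

lemma isUnit_denom {M : Matrix (Fin 4) (Fin 4) ℝ} (h : Mᵀ * J4 * M = J4)
    {Ω : Matrix (Fin 2) (Fin 2) ℂ} (hΩ : Ω ∈ H2) : IsUnit (blkC M * Ω + blkD M) := by
  rw [← Matrix.mulVec_injective_iff_isUnit, ← Matrix.coe_mulVecLin, injective_iff_map_eq_zero]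
  intro v hv
  rw [Matrix.mulVecLin_apply] at hv
  by_contra hne
  have hpos := (mem_H2_iff.1 hΩ).2.dotProduct_mulVec_pos hne
  have hv' : star v ᵥ* (Ωᴴ * (blkC M)ᵀ + (blkD M)ᵀ) = 0 := by
    rw [← conjTranspose_denom, ← Matrix.star_mulVec, hv, star_zero]
  rw [← sub_eq_of_sympl h Ωᴴ Ω, Matrix.smul_mulVec, Matrix.sub_mulVec, ← Matrix.mulVec_mulVec,
    ← Matrix.mulVec_mulVec, hv, Matrix.mulVec_zero, sub_zero, dotProduct_smul,
    Matrix.dotProduct_mulVec, hv', zero_dotProduct, smul_zero] at hpos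
  exact hpos.false

lemma act_mem_H2 {M : Matrix (Fin 4) (Fin 4) ℝ} (h : Mᵀ * J4 * M = J4)
    {Ω : Matrix (Fin 2) (Fin 2) ℂ} (hΩ : Ω ∈ H2) : act M Ω ∈ H2 := by
  have hY := isUnit_denom h hΩ
  have hYT := (Matrix.isUnit_transpose _).2 hY
  have hYH := (Matrix.isUnit_conjTranspose _).2 hY
  have hdet := (Matrix.isUnit_iff_isUnit_det _).1 hY
  have hW : act M Ω * (blkC M * Ω + blkD M) = blkA M * Ω + blkB M :=
    Matrix.nonsing_inv_mul_cancel_right _ _ hdet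
  have hT := sub_eq_of_sympl h Ω Ω
  have hH := sub_eq_of_sympl h Ωᴴ Ω
  rw [← conjTranspose_num, ← conjTranspose_denom, ← hW, Matrix.conjTranspose_mul] at hH
  rw [show Ω * (blkC M)ᵀ + (blkD M)ᵀ = (blkC M * Ω + blkD M)ᵀ by simp [hΩ.1],
    show Ω * (blkA M)ᵀ + (blkB M)ᵀ = (blkA M * Ω + blkB M)ᵀ by simp [hΩ.1],
    ← hW, Matrix.transpose_mul, sub_self, sub_eq_zero] at hT
  refine mem_H2_iff.2 ⟨?_, ?_⟩
  · refine (hYT.mul_left_cancel (hY.mul_right_cancel ?_)).symm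
    rw [mul_assoc, hT]
  · have hpos := (mem_H2_iff.1 hΩ).2
    rw [← hH] at hpos
    have hpos' := hpos.conjTranspose_mul_mul_same (B := (blkC M * Ω + blkD M)⁻¹)
      (Matrix.mulVec_injective_of_isUnit ((Matrix.isUnit_nonsing_inv_iff).2 hY))
    convert hpos' using 1
    generalize blkC M * Ω + blkD M = Y at *
    have e₁ : Y * Y⁻¹ = 1 := Matrix.mul_nonsing_inv _ hdet
    have e₂ : Y⁻¹ᴴ * Yᴴ = 1 := by rw [← Matrix.conjTranspose_mul, e₁, Matrix.conjTranspose_one]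
    rw [mul_smul_comm, smul_mul_assoc]
    congr 1
    calc _ = (Y⁻¹ᴴ * Yᴴ) * (act M Ω - (act M Ω)ᴴ) * (Y * Y⁻¹) := by rw [e₁, e₂]; simp
      _ = _ := by noncomm_ring

end

lemma mem_HHat2_iff {Ω : Matrix (Fin 2) (Fin 2) ℂ} :
    Ω ∈ HHat2 ↔ Ω ∈ H2 ∧ !![0, 1; 1, 0] * Ω = Ω * !![0, 1; 1, 0] := by
  refine and_congr_right fun _ => ?_
  have hq : (!![0, 1; 1, 0] : Matrix (Fin 2) (Fin 2) ℂ) * !![0, 1; 1, 0] = 1 := by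
    ext i j; fin_cases i <;> fin_cases j <;> simp
  rw [act_QM]
  constructor <;> intro h
  · conv_rhs => rw [← h]
    rw [mul_assoc _ !![0, 1; 1, 0] !![0, 1; 1, 0], hq, mul_one]
  · rw [h, mul_assoc, hq, mul_one]

lemma blk_of_QM_comm {M : Matrix (Fin 4) (Fin 4) ℝ} {ε : ℝ} (h : QM * M = ε • (M * QM)) :
    !![0, 1; 1, 0] * blkA M = (ε : ℂ) • (blkA M * !![0, 1; 1, 0]) ∧
    !![0, 1; 1, 0] * blkB M = (ε : ℂ) • (blkB M * !![0, 1; 1, 0]) ∧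
    !![0, 1; 1, 0] * blkC M = (ε : ℂ) • (blkC M * !![0, 1; 1, 0]) ∧
    !![0, 1; 1, 0] * blkD M = (ε : ℂ) • (blkD M * !![0, 1; 1, 0]) := by
  have e (i j) : (((QM * M) i j : ℝ) : ℂ) = ((ε • (M * QM)) i j : ℝ) := by rw [h]
  refine ⟨?_, ?_, ?_, ?_⟩ <;> ext i j
  · have := e (Fin.castAdd 2 i) (Fin.castAdd 2 j)
    fin_cases i <;> fin_cases j <;>
    simpa [Matrix.mul_apply, Fin.sum_univ_four, blkA, Fin.natAdd, Fin.castAdd, QM] using this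
  · have := e (Fin.castAdd 2 i) (Fin.natAdd 2 j)
    fin_cases i <;> fin_cases j <;>
    simpa [Matrix.mul_apply, Fin.sum_univ_four, blkB, Fin.natAdd, Fin.castAdd, QM] using this
  · have := e (Fin.natAdd 2 i) (Fin.castAdd 2 j)
    fin_cases i <;> fin_cases j <;>
    simpa [Matrix.mul_apply, Fin.sum_univ_four, blkC, Fin.natAdd, Fin.castAdd, QM] using this
  · have := e (Fin.natAdd 2 i) (Fin.natAdd 2 j)
    fin_cases i <;> fin_cases j <;>
    simpa [Matrix.mul_apply, Fin.sum_univ_four, blkD, Fin.natAdd, Fin.castAdd, QM] using this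

lemma act_mem_HHat2 {M : Matrix (Fin 4) (Fin 4) ℝ} (h : Mᵀ * J4 * M = J4) {ε : ℝ}
    (hQ : QM * M = ε • (M * QM)) {Ω : Matrix (Fin 2) (Fin 2) ℂ} (hΩ : Ω ∈ HHat2) :
    act M Ω ∈ HHat2 := by
  rw [mem_HHat2_iff] at hΩ ⊢
  refine ⟨act_mem_H2 h hΩ.1, ?_⟩
  obtain ⟨hA, hB, hC, hD⟩ := blk_of_QM_comm hQ
  have hY := isUnit_denom h hΩ.1
  have hW : act M Ω * (blkC M * Ω + blkD M) = blkA M * Ω + blkB M :=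
    Matrix.nonsing_inv_mul_cancel_right _ _ ((Matrix.isUnit_iff_isUnit_det _).1 hY)
  have hΩ₂ := hΩ.2
  generalize (!![0, 1; 1, 0] : Matrix (Fin 2) (Fin 2) ℂ) = q at *
  have hqX : q * (blkA M * Ω + blkB M) = (ε : ℂ) • ((blkA M * Ω + blkB M) * q) := by
    rw [mul_add, ← mul_assoc, hA, hB, add_mul, smul_add, smul_mul_assoc, mul_assoc, hΩ₂, mul_assoc]
  have hqY : q * (blkC M * Ω + blkD M) = (ε : ℂ) • ((blkC M * Ω + blkD M) * q) := by
    rw [mul_add, ← mul_assoc, hC, hD, add_mul, smul_add, smul_mul_assoc, mul_assoc, hΩ₂, mul_assoc]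
  refine hY.mul_right_cancel ?_
  rw [mul_assoc, hW, hqX, mul_assoc, hqY, mul_smul_comm, ← hW, mul_assoc]

lemma imaginary_mem_HHat2 {s t : ℝ} (hs : |t| < s) :
    !![(s : ℂ) * I, t * I; t * I, s * I] ∈ HHat2 := by
  rw [mem_HHat2_iff]
  refine ⟨⟨?_, .of_dotProduct_mulVec_pos ?_ fun x hx => ?_⟩, ?_⟩
  · ext i j; fin_cases i <;> fin_cases j <;> simp
  · ext i j; fin_cases i <;> fin_cases j <;> simp
  · have hx' : x 0 ≠ 0 ∨ x 1 ≠ 0 := by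
      contrapose! hx
      ext i; fin_cases i <;> simp [hx]
    obtain ⟨h₁, h₂⟩ := abs_lt.1 hs
    simp [dotProduct, Matrix.mulVec, Fin.sum_univ_two]
    have : 0 < x 0 ^ 2 + x 1 ^ 2 := by
      rcases hx' with hx' | hx' <;> positivity
    rcases le_total 0 t with ht | ht
    · nlinarith [mul_nonneg ht (sq_nonneg (x 0 + x 1)), mul_pos (sub_pos.2 h₂) this]
    · nlinarith [mul_nonneg (neg_nonneg.2 ht) (sq_nonneg (x 0 - x 1)),
        mul_pos (neg_lt_iff_pos_add.1 h₁) this]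
  · ext i j; fin_cases i <;> fin_cases j <;> simp

lemma transpose_mul_swap_mul_of_act_mem {M : Matrix (Fin 4) (Fin 4) ℝ}
    {Ω : Matrix (Fin 2) (Fin 2) ℂ} (h : act M Ω ∈ HHat2) :
    (blkA M * Ω + blkB M)ᵀ * !![0, 1; 1, 0] * (blkC M * Ω + blkD M) =
      (blkC M * Ω + blkD M)ᵀ * !![0, 1; 1, 0] * (blkA M * Ω + blkB M) := by
  rw [mem_HHat2_iff] at h
  have hdet : IsUnit (blkC M * Ω + blkD M).det := by
    by_contra hY
    have h0 : act M Ω = 0 := by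
      rw [act, Matrix.nonsing_inv_apply_not_isUnit _ hY, mul_zero]
    have := h.1.2.diag_pos (i := 0)
    simp [h0] at this
  have hW : act M Ω * (blkC M * Ω + blkD M) = blkA M * Ω + blkB M :=
    Matrix.nonsing_inv_mul_cancel_right _ _ hdet
  rw [← hW, Matrix.transpose_mul, h.1.1, mul_assoc _ (act M Ω), ← h.2]
  simp only [mul_assoc]

lemma swap_form_apply (M : Matrix (Fin 4) (Fin 4) ℝ) (a b : ℂ) :
    ((blkA M * !![a, b; b, a] + blkB M)ᵀ * !![0, 1; 1, 0] *
        (blkC M * !![a, b; b, a] + blkD M) : Matrix (Fin 2) (Fin 2) ℂ) 0 1 -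
      ((blkC M * !![a, b; b, a] + blkD M)ᵀ * !![0, 1; 1, 0] *
        (blkA M * !![a, b; b, a] + blkB M) : Matrix (Fin 2) (Fin 2) ℂ) 0 1 =
      (Mᵀ * (QM * J4) * M) 0 1 * (a ^ 2 - b ^ 2) +
      ((Mᵀ * (QM * J4) * M) 0 3 - (Mᵀ * (QM * J4) * M) 1 2) * a +
      ((Mᵀ * (QM * J4) * M) 1 3 - (Mᵀ * (QM * J4) * M) 0 2) * b +
      (Mᵀ * (QM * J4) * M) 2 3 := by
  simp [Matrix.mul_apply, Fin.sum_univ_four, Fin.sum_univ_two, QM, J4, blkA, blkB, blkC, blkD,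
    Fin.natAdd, Fin.castAdd]
  ring

lemma QM_mul_J4 : QM * J4 = !![0, 0, 0, 1; 0, 0, 1, 0; 0, -1, 0, 0; -1, 0, 0, 0] := by
  ext i j
  fin_cases i <;> fin_cases j <;> simp [QM, J4, Matrix.mul_apply, Fin.sum_univ_four]

lemma J4_mul_QM : J4 * QM = QM * J4 := by
  rw [QM_mul_J4]
  ext i j
  fin_cases i <;> fin_cases j <;> simp [QM, J4, Matrix.mul_apply, Fin.sum_univ_four]

lemma QM_mul_self : QM * QM = 1 := by
  ext i j
  fin_cases i <;> fin_cases j <;> simp [QM, Matrix.mul_apply, Fin.sum_univ_four]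

lemma J4_mul_self : J4 * J4 = -1 := by
  ext i j
  fin_cases i <;> fin_cases j <;> simp [J4, Matrix.mul_apply, Fin.sum_univ_four]

lemma exists_swap_form_eq {M : Matrix (Fin 4) (Fin 4) ℝ} (h : ∀ Ω ∈ HHat2, act M Ω ∈ HHat2) :
    ∃ x y : ℝ, Mᵀ * (J4 * QM) * M = x • J4 + y • (J4 * QM) := by
  set K := Mᵀ * (QM * J4) * M with hK
  have hskew : Kᵀ = -K := by
    have : (QM * J4)ᵀ = -(QM * J4) := by
      rw [QM_mul_J4]
      ext i j
      fin_cases i <;> fin_cases j <;> simp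
    rw [hK, Matrix.transpose_mul, Matrix.transpose_mul, this]
    simp [mul_assoc]
  have hsk (i j) : K j i = -K i j := congrFun (congrFun hskew i) j
  have key (s t : ℝ) (hst : |t| < s) : K 0 1 * (t ^ 2 - s ^ 2) + K 2 3 = 0 ∧
      (K 0 3 - K 1 2) * s + (K 1 3 - K 0 2) * t = 0 := by
    have e := swap_form_apply M (s * I) (t * I)
    rw [transpose_mul_swap_mul_of_act_mem (h _ (imaginary_mem_HHat2 hst)), sub_self, ← hK] at e
    have hre := congrArg Complex.re e
    have him := congrArg Complex.im e
    simp [pow_two] at hre him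
    constructor <;> linarith
  obtain ⟨h₁, h₂⟩ := key 1 0 (by norm_num)
  obtain ⟨h₃, -⟩ := key 2 0 (by norm_num)
  obtain ⟨-, h₄⟩ := key 2 1 (by norm_num)
  refine ⟨K 0 2, K 0 3, ?_⟩
  rw [J4_mul_QM, ← hK, QM_mul_J4, J4]
  ext i j
  have := hsk i j
  have := hsk i i
  fin_cases i <;> fin_cases j <;> simp at * <;>
    linarith [hsk 0 2, hsk 0 3, hsk 0 1, hsk 2 3, hsk 1 2, hsk 1 3]

lemma QM_comm_of_preserves {M : Matrix (Fin 4) (Fin 4) ℝ} (hM : Mᵀ * J4 * M = J4)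
    (h : ∀ Ω ∈ HHat2, act M Ω ∈ HHat2) : QM * M = M * QM ∨ QM * M = -(M * QM) := by
  obtain ⟨x, y, hxy⟩ := exists_swap_form_eq h
  have hNM : (-J4 * Mᵀ * J4) * M = 1 := by
    rw [mul_assoc, mul_assoc, ← mul_assoc Mᵀ, hM, neg_mul, J4_mul_self, neg_neg]
  have hMN := mul_eq_one_comm.1 hNM
  set N := -J4 * Mᵀ * J4 with hN
  have hP : N * QM * M = x • 1 + y • QM := by
    calc N * QM * M = -(J4 * (Mᵀ * (J4 * QM) * M)) := by rw [hN]; noncomm_ring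
      _ = _ := by
        rw [hxy, mul_add, mul_smul_comm, mul_smul_comm, ← mul_assoc, J4_mul_self]
        simp [add_comm]
  have hx : x = 0 := by
    have htr := congrArg Matrix.trace hP
    rw [mul_assoc, Matrix.trace_mul_comm, mul_assoc, hMN] at htr
    simp [Matrix.trace, Fin.sum_univ_four, QM] at htr
    linarith
  have hQM : QM * M = y • (M * QM) := by
    calc QM * M = (M * N) * QM * M := by rw [hMN, one_mul]
      _ = M * (N * QM * M) := by simp only [mul_assoc]
      _ = _ := by rw [hP, hx]; simp
  have hy : y * y = 1 := by
    have : (y * y) • M = M := by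
      calc (y * y) • M = y • (y • (M * QM) * QM) := by
            rw [smul_mul_assoc, mul_assoc, QM_mul_self, mul_one, smul_smul]
        _ = QM * (QM * M) := by
            rw [← hQM, mul_assoc, ← mul_smul_comm, ← hQM]
        _ = M := by rw [← mul_assoc, QM_mul_self, one_mul]
    have := congrArg (N * ·) this
    simp only [mul_smul_comm, hNM] at this
    simpa using congrFun (congrFun this 0) 0
  rcases mul_self_eq_one_iff.1 hy with rfl | rfl
  · left; simpa using hQM
  · right; simpa using hQM

lemma mem_GHat_iff {M : Matrix (Fin 4) (Fin 4) ℝ} :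
    M ∈ GHat ↔ M ∈ Sp4 ∧ (QM * M = M * QM ∨ QM * M = -(M * QM)) := by
  refine and_congr_right fun hM => ⟨QM_comm_of_preserves hM.2, ?_⟩
  rintro (h | h) Ω hΩ
  · exact act_mem_HHat2 hM.2 (ε := 1) (by simpa using h) hΩ
  · exact act_mem_HHat2 hM.2 (ε := -1) (by simpa using h) hΩ

lemma inv_sqrt_two_mul_self : ((Real.sqrt 2 : ℂ))⁻¹ * ((Real.sqrt 2 : ℂ))⁻¹ = 1 / 2 := by
  rw [← mul_inv, ← ofReal_mul, Real.mul_self_sqrt (by norm_num)]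
  norm_num

lemma Tmat_mul_inv : Tmat * (((Real.sqrt 2 : ℂ))⁻¹ •
    !![1,0,-I,0; 0,1,0,-I; 1,0,I,0; 0,1,0,I]) = 1 := by
  rw [Tmat, smul_mul_smul_comm, inv_sqrt_two_mul_self]
  ext i j
  fin_cases i <;> fin_cases j <;> simp <;> norm_num

lemma QC_mul_Tmat : QC * Tmat = Tmat * QC := by
  rw [Tmat, mul_smul_comm, smul_mul_assoc]
  congr 1
  ext i j
  fin_cases i <;> fin_cases j <;> simp [Matrix.mul_apply, Fin.sum_univ_four, QC, QM]

lemma Tmat_transpose_mul : Tmatᵀ * J4C * Tmat = (-I) • J4C := by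
  rw [Tmat, Matrix.transpose_smul, smul_mul_assoc, smul_mul_smul_comm, inv_sqrt_two_mul_self]
  ext i j
  fin_cases i <;> fin_cases j <;>
    simp [Matrix.mul_apply, Fin.sum_univ_four, J4C, J4] <;> ring

lemma isUnit_Tmat : IsUnit Tmat :=
  IsUnit.of_mul_eq_one _ Tmat_mul_inv

lemma Tmat_mul_cancel : Tmat * Tmat⁻¹ = 1 :=
  Matrix.mul_nonsing_inv _ ((Matrix.isUnit_iff_isUnit_det _).1 isUnit_Tmat)

lemma Tmat_inv_mul : Tmat⁻¹ * Tmat = 1 :=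
  Matrix.nonsing_inv_mul _ ((Matrix.isUnit_iff_isUnit_det _).1 isUnit_Tmat)

lemma eq_Tmat_conj_iff {h N : Matrix (Fin 4) (Fin 4) ℂ} :
    Tmat⁻¹ * N * Tmat = h ↔ Tmat * h = N * Tmat := by
  constructor
  · rintro rfl
    rw [← mul_assoc, ← mul_assoc, Tmat_mul_cancel, one_mul]
  · intro e
    rw [mul_assoc, ← e, ← mul_assoc, Tmat_inv_mul, one_mul]

lemma map_ofReal_injective :
    Function.Injective fun M : Matrix (Fin 4) (Fin 4) ℝ => M.map Complex.ofReal :=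
  Matrix.map_injective Complex.ofReal_injective

lemma map_ofReal_mul (M N : Matrix (Fin 4) (Fin 4) ℝ) :
    (M * N).map Complex.ofReal = M.map Complex.ofReal * N.map Complex.ofReal :=
  Matrix.map_mul (f := Complex.ofRealHom)

lemma sympl_iff_of_Tmat_mul {M : Matrix (Fin 4) (Fin 4) ℝ} {h : Matrix (Fin 4) (Fin 4) ℂ}
    (e : Tmat * h = M.map Complex.ofReal * Tmat) :
    hᵀ * J4C * h = J4C ↔ Mᵀ * J4 * M = J4 := by
  have e₁ : (-I) • (hᵀ * J4C * h) =
      Tmatᵀ * (Mᵀ * J4 * M).map Complex.ofReal * Tmat := by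
    calc (-I) • (hᵀ * J4C * h) = hᵀ * (Tmatᵀ * J4C * Tmat) * h := by
          rw [Tmat_transpose_mul, mul_smul_comm, smul_mul_assoc]
      _ = (Tmat * h)ᵀ * J4C * (Tmat * h) := by
          rw [Matrix.transpose_mul]
          simp only [mul_assoc]
      _ = _ := by
          rw [e, map_ofReal_mul, map_ofReal_mul, Matrix.transpose_mul, J4C, Matrix.transpose_map]
          simp only [mul_assoc]
  have hI : (-I) ≠ 0 := by simp
  rw [← (smul_right_injective _ hI).eq_iff, ← map_ofReal_injective.eq_iff, e₁,
    ← Tmat_transpose_mul, isUnit_Tmat.mul_left_inj,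
    ((Matrix.isUnit_transpose _).2 isUnit_Tmat).mul_right_inj]
  rfl

lemma QC_comm_iff_of_Tmat_mul {M : Matrix (Fin 4) (Fin 4) ℝ} {h : Matrix (Fin 4) (Fin 4) ℂ}
    (e : Tmat * h = M.map Complex.ofReal * Tmat) :
    (QC * h = h * QC ∨ QC * h = -(h * QC)) ↔ (QM * M = M * QM ∨ QM * M = -(M * QM)) := by
  have e₁ : Tmat * (QC * h) = (QM * M).map Complex.ofReal * Tmat := by
    rw [← mul_assoc, ← QC_mul_Tmat, mul_assoc, e, ← mul_assoc, map_ofReal_mul, QC]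
  have e₂ : Tmat * (h * QC) = (M * QM).map Complex.ofReal * Tmat := by
    rw [← mul_assoc, e, mul_assoc, ← QC_mul_Tmat, ← mul_assoc, map_ofReal_mul, QC]
  have e₃ : (-(M * QM)).map Complex.ofReal = -(M * QM).map Complex.ofReal := by
    ext i j
    simp only [Matrix.map_apply, Matrix.neg_apply, Complex.ofReal_neg]
  rw [← isUnit_Tmat.mul_right_inj, ← isUnit_Tmat.mul_right_inj (b := QC * h) (c := -(h * QC)),
    mul_neg, e₁, e₂, ← neg_mul, ← e₃, isUnit_Tmat.mul_left_inj, isUnit_Tmat.mul_left_inj,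
    map_ofReal_injective.eq_iff, map_ofReal_injective.eq_iff]

lemma mem_Sp4_iff {M : Matrix (Fin 4) (Fin 4) ℝ} : M ∈ Sp4 ↔ Mᵀ * J4 * M = J4 := by
  refine ⟨fun h => h.2, fun h => ⟨(Matrix.isUnit_iff_isUnit_det _).1 ?_, h⟩⟩
  refine IsUnit.of_mul_eq_one_right (-J4 * Mᵀ * J4) ?_
  rw [mul_assoc, mul_assoc, ← mul_assoc Mᵀ, h, neg_mul, J4_mul_self, neg_neg]

lemma GHatStar_eq : GHatStar = {h : Matrix (Fin 4) (Fin 4) ℂ |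
    hᵀ * J4C * h = J4C ∧ (QC * h = h * QC ∨ QC * h = -(h * QC)) ∧ h ∈ Gstar} := by
  ext h
  constructor
  · rintro ⟨M, hM, e⟩
    rw [mem_GHat_iff] at hM
    have e' := eq_Tmat_conj_iff.1 e
    exact ⟨(sympl_iff_of_Tmat_mul e').2 hM.1.2, (QC_comm_iff_of_Tmat_mul e').2 hM.2, M, hM.1, e⟩
  · rintro ⟨-, hQ, M, hM, e⟩
    exact ⟨M, mem_GHat_iff.2 ⟨hM, (QC_comm_iff_of_Tmat_mul (eq_Tmat_conj_iff.1 e)).1 hQ⟩, e⟩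

lemma map_reindex_fromBlocks (a b c d : Matrix (Fin 2) (Fin 2) ℝ) :
    (Matrix.reindex finSumFinEquiv finSumFinEquiv (Matrix.fromBlocks a b c d)).map ofReal =
      fromB (a.map ofReal) (b.map ofReal) (c.map ofReal) (d.map ofReal) := by
  rw [fromB, ← Matrix.fromBlocks_map]
  rfl

lemma exists_Tmat_mul_fromB (α β : Matrix (Fin 2) (Fin 2) ℂ) :
    ∃ M : Matrix (Fin 4) (Fin 4) ℝ,
      Tmat * fromB α β (cj β) (cj α) = M.map Complex.ofReal * Tmat := by
  refine ⟨Matrix.reindex finSumFinEquiv finSumFinEquiv (Matrix.fromBlocks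
    ((α + β).map Complex.re) ((α - β).map Complex.im)
    (-(α + β).map Complex.im) ((α - β).map Complex.re)), ?_⟩
  rw [Tmat, smul_mul_assoc, mul_smul_comm, fromB_eq]
  congr 1
  rw [map_reindex_fromBlocks, fromB_eq]
  ext i j
  fin_cases i <;> fin_cases j <;>
    simp [Matrix.mul_apply, Fin.sum_univ_four, cj, Complex.ext_iff] <;> ring_nf <;> simp

lemma fromB_mem_Gstar {α β : Matrix (Fin 2) (Fin 2) ℂ}
    (h : (fromB α β (cj β) (cj α))ᵀ * J4C * fromB α β (cj β) (cj α) = J4C) :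
    fromB α β (cj β) (cj α) ∈ Gstar := by
  obtain ⟨M, e⟩ := exists_Tmat_mul_fromB α β
  exact ⟨M, mem_Sp4_iff.2 ((sympl_iff_of_Tmat_mul e).1 h), eq_Tmat_conj_iff.2 e⟩

lemma J4C_mul_self : J4C * J4C = -1 := by
  rw [J4C, ← map_ofReal_mul, J4_mul_self]
  ext i j
  fin_cases i <;> fin_cases j <;> simp

lemma sympl_transpose {h : Matrix (Fin 4) (Fin 4) ℂ} (e : hᵀ * J4C * h = J4C) :
    h * J4C * hᵀ = J4C := by
  have : h * (-J4C * hᵀ * J4C) = 1 := mul_eq_one_comm.1 <| by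
    rw [mul_assoc, mul_assoc, ← mul_assoc hᵀ, e, neg_mul, J4C_mul_self, neg_neg]
  calc h * J4C * hᵀ = h * (-J4C * hᵀ * J4C) * J4C + h * J4C * hᵀ * (1 + J4C * J4C) := by
        noncomm_ring
    _ = J4C := by rw [this, J4C_mul_self]; simp

lemma sympl_transpose_iff {h : Matrix (Fin 4) (Fin 4) ℂ} :
    hᵀ * J4C * h = J4C ↔ h * J4C * hᵀ = J4C :=
  ⟨sympl_transpose, fun e => by simpa using sympl_transpose (h := hᵀ) (by simpa using e)⟩

lemma fromB_mul (a b c d a' b' c' d' : Matrix (Fin 2) (Fin 2) ℂ) :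
    fromB a b c d * fromB a' b' c' d' =
      fromB (a * a' + b * c') (a * b' + b * d') (c * a' + d * c') (c * b' + d * d') := by
  simp only [fromB, Matrix.reindex_apply, Matrix.submatrix_mul_equiv, Matrix.fromBlocks_multiply]

lemma fromB_inj {a b c d a' b' c' d' : Matrix (Fin 2) (Fin 2) ℂ} :
    fromB a b c d = fromB a' b' c' d' ↔ a = a' ∧ b = b' ∧ c = c' ∧ d = d' := by
  rw [fromB, fromB, (Matrix.reindex _ _).injective.eq_iff, Matrix.fromBlocks_inj]

lemma fromB_neg (a b c d : Matrix (Fin 2) (Fin 2) ℂ) :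
    -fromB a b c d = fromB (-a) (-b) (-c) (-d) := by
  rw [fromB, fromB, ← Matrix.fromBlocks_neg]
  rfl

lemma fromB_transpose (a b c d : Matrix (Fin 2) (Fin 2) ℂ) :
    (fromB a b c d)ᵀ = fromB aᵀ cᵀ bᵀ dᵀ := by
  rw [fromB, fromB, ← Matrix.fromBlocks_transpose]
  rfl

lemma J4C_eq_fromB : J4C = fromB 0 1 (-1) 0 := by
  rw [fromB_eq]
  ext i j
  fin_cases i <;> fin_cases j <;> simp [J4C, J4]

lemma QC_eq_fromB : QC = fromB !![0, 1; 1, 0] 0 0 !![0, 1; 1, 0] := by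
  rw [fromB_eq]
  ext i j
  fin_cases i <;> fin_cases j <;> simp [QC, QM]

lemma symm_of_swap_comm {α β : Matrix (Fin 2) (Fin 2) ℂ} {ε : ℂ}
    (hα : !![0, 1; 1, 0] * α = ε • (α * !![0, 1; 1, 0]))
    (hβ : !![0, 1; 1, 0] * β = ε • (β * !![0, 1; 1, 0])) : α * βᵀ = β * αᵀ := by
  have a₀ : α 1 0 = ε * α 0 1 := by simpa [Matrix.mul_apply] using congrFun (congrFun hα 0) 0
  have a₁ : α 1 1 = ε * α 0 0 := by simpa [Matrix.mul_apply] using congrFun (congrFun hα 0) 1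
  have b₀ : β 1 0 = ε * β 0 1 := by simpa [Matrix.mul_apply] using congrFun (congrFun hβ 0) 0
  have b₁ : β 1 1 = ε * β 0 0 := by simpa [Matrix.mul_apply] using congrFun (congrFun hβ 0) 1
  ext i j
  fin_cases i <;> fin_cases j <;>
    simp [Matrix.mul_apply, Fin.sum_univ_two, a₀, a₁, b₀, b₁] <;> ring

lemma swap_comm_of_QC_comm {α β : Matrix (Fin 2) (Fin 2) ℂ}
    (h : QC * fromB α β (cj β) (cj α) = fromB α β (cj β) (cj α) * QC ∨
      QC * fromB α β (cj β) (cj α) = -(fromB α β (cj β) (cj α) * QC)) :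
    ∃ ε : ℂ, !![0, 1; 1, 0] * α = ε • (α * !![0, 1; 1, 0]) ∧
      !![0, 1; 1, 0] * β = ε • (β * !![0, 1; 1, 0]) ∧
      !![0, 1; 1, 0] * cj β = ε • (cj β * !![0, 1; 1, 0]) := by
  simp only [QC_eq_fromB, fromB_mul, fromB_neg, fromB_inj, zero_mul, mul_zero, add_zero,
    zero_add] at h
  rcases h with ⟨hα, hβ, hβ', -⟩ | ⟨hα, hβ, hβ', -⟩
  · exact ⟨1, by rw [hα, one_smul], by rw [hβ, one_smul], by rw [hβ', one_smul]⟩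
  · exact ⟨-1, by rw [hα, neg_one_smul], by rw [hβ, neg_one_smul],
      by rw [hβ', neg_one_smul]⟩

lemma symm_of_QC_comm {α β : Matrix (Fin 2) (Fin 2) ℂ}
    (h : QC * fromB α β (cj β) (cj α) = fromB α β (cj β) (cj α) * QC ∨
      QC * fromB α β (cj β) (cj α) = -(fromB α β (cj β) (cj α) * QC)) :
    α * βᵀ = β * αᵀ ∧ α * (cj β)ᵀ = cj β * αᵀ := by
  obtain ⟨ε, hα, hβ, hβ'⟩ := swap_comm_of_QC_comm h
  exact ⟨symm_of_swap_comm hα hβ, symm_of_swap_comm hα hβ'⟩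

lemma fromB_sympl_iff {α β : Matrix (Fin 2) (Fin 2) ℂ} (hs : α * βᵀ = β * αᵀ) :
    (fromB α β (cj β) (cj α))ᵀ * J4C * fromB α β (cj β) (cj α) = J4C ↔
      α * (cj α)ᵀ - β * (cj β)ᵀ = 1 := by
  rw [sympl_transpose_iff, J4C_eq_fromB, fromB_transpose, fromB_mul, fromB_mul, fromB_inj]
  simp only [mul_zero, mul_one, mul_neg, zero_add, add_zero, neg_mul, neg_add_eq_sub]
  refine ⟨fun h => h.2.1, fun h => ⟨sub_eq_zero.2 hs, h, ?_, ?_⟩⟩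
  · have := congrArg Matrix.transpose h
    simp only [Matrix.transpose_sub, Matrix.transpose_mul, Matrix.transpose_transpose,
      Matrix.transpose_one] at this
    rw [← this, neg_sub]
  · have := congrArg cj hs
    simp only [cj, Matrix.map_mul, Matrix.transpose_map] at this ⊢
    rw [this, sub_self]

/-- `Ĝ_* = {h | ᵗh J₄ h = J₄, Qh = ±hQ, h ∈ T⁻¹Sp(4,ℝ)T}`; equivalently,
`h = [[α,β],[β̄,ᾱ]]` lies in `Ĝ_*` iff `α ᵗᾱ - β ᵗβ̄ = I₂`, `α ᵗβ̄ = β̄ ᵗα`, and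
`Qh = ε hQ` for some `ε = ±1`. -/
theorem statement4 :
    (GHatStar = {h : Matrix (Fin 4) (Fin 4) ℂ |
        hᵀ * J4C * h = J4C ∧ (QC * h = h * QC ∨ QC * h = -(h * QC)) ∧ h ∈ Gstar}) ∧
    (∀ α β : Matrix (Fin 2) (Fin 2) ℂ,
        fromB α β (cj β) (cj α) ∈ GHatStar ↔
          (α * (cj α)ᵀ - β * (cj β)ᵀ = 1 ∧
           α * (cj β)ᵀ = cj β * αᵀ ∧
           (QC * fromB α β (cj β) (cj α) = fromB α β (cj β) (cj α) * QC ∨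
            QC * fromB α β (cj β) (cj α) = -(fromB α β (cj β) (cj α) * QC)))) := by
  refine ⟨GHatStar_eq, fun α β => ?_⟩
  rw [GHatStar_eq]
  constructor
  · rintro ⟨hJ, hQ, -⟩
    obtain ⟨hs, hs'⟩ := symm_of_QC_comm hQ
    exact ⟨(fromB_sympl_iff hs).1 hJ, hs', hQ⟩
  · rintro ⟨h₁, -, hQ⟩
    have hJ := (fromB_sympl_iff (symm_of_QC_comm hQ).1).2 h₁
    exact ⟨hJ, hQ, fromB_mem_Gstar hJ⟩

end
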